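/- arXiv:1902.09373 — 10 statements merged into one kernel-verified Lean document; each statement's English description precedes it below -/
import Mathlib

section
/- For every n ≥ 2 and every permutation π in the symmetric group S_n there exists a unique tuple of integers (i_2, i_3, …, i_n) with 0 ≤ i_k < k for each 2 ≤ k ≤ n such that π = t_2^{i_2} · t_3^{i_3} ⋯ t_n^{i_n} (factors in increasing order of the index). -/
/-!
Setup for the symmetric group `Sₙ`, realized as `Equiv.Perm (Fin n)` with `Fin n`
encoding `{1, …, n}` (0-indexed positions).  The paper multiplies permutations
left-to-right: `(π·σ)(i) = σ(π(i))`, while Mathlib composes right-to-left: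
`(π * σ) i = π (σ i)`.  Hence a paper product `a₁ · a₂ ⋯ a_k` is encoded as the
Mathlib product `a_k * ⋯ * a₂ * a₁` (the leftmost paper factor acts first).
-/

open Equiv Finset

/-- The adjacent transposition `sᵢ` (1-indexed values): the transposition `(i, i+1)`,
as a permutation of `Fin n`; junk value `1` outside the range `1 ≤ i ≤ n-1`. -/
def sP (n : ℕ) (i : ℕ) : Equiv.Perm (Fin n) :=
  if h : i < n then Equiv.swap ⟨i - 1, by omega⟩ ⟨i, h⟩ else 1

/-- `tₘ = s₁·s₂⋯s_{m−1}` (left-to-right), i.e. the `m`-cycle sending `1 ↦ m` and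
`j ↦ j−1` for `2 ≤ j ≤ m` (1-indexed), fixing every `j > m`; `t₁ = 1`. -/
def tP (n : ℕ) (m : ℕ) : Equiv.Perm (Fin n) :=
  if h : m - 1 < n then ((⟨m - 1, h⟩ : Fin n).cycleRange)⁻¹ else 1

/-- The paper's left-to-right product `f a · f (a+1) ⋯ f b` (increasing indices,
so `f a` acts first), encoded in Mathlib's composition order. -/
def ogsProd {n : ℕ} (a b : ℕ) (f : ℕ → Equiv.Perm (Fin n)) : Equiv.Perm (Fin n) :=
  ((List.range' a (b + 1 - a)).map f).reverse.prod

/-- The paper's left-to-right product `f b · f (b−1) ⋯ f a` (decreasing indices,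
so `f b` acts first), encoded in Mathlib's composition order. -/
def ogsProdDesc {n : ℕ} (a b : ℕ) (f : ℕ → Equiv.Perm (Fin n)) : Equiv.Perm (Fin n) :=
  ((List.range' a (b + 1 - a)).map f).prod

/-- The Coxeter length of `π`: the number of inversions, i.e. of pairs `i < j`
with `π(i) > π(j)`. -/
def len {n : ℕ} (π : Equiv.Perm (Fin n)) : ℕ :=
  (Finset.univ.filter fun p : Fin n × Fin n => p.1 < p.2 ∧ π p.2 < π p.1).card

/-- The descent set of `π`: the set of 1-indexed positions `i ∈ {1, …, n−1}`
with `π(i) > π(i+1)`. -/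
def descents {n : ℕ} (π : Equiv.Perm (Fin n)) : Finset ℕ :=
  (Finset.Ico 1 n).filter fun i => ∃ h : i < n, π ⟨i, h⟩ < π ⟨i - 1, by omega⟩

theorem tP_apply_of_lt {n m : ℕ} (x : Fin n) (h : m - 1 < x.val) : tP n m x = x := by
  have hm : m - 1 < n := h.trans x.isLt
  rw [tP, dif_pos hm, Equiv.Perm.inv_eq_iff_eq]
  exact (Fin.cycleRange_of_gt (Fin.lt_def.mpr h)).symm

theorem tP_succ_apply_succ {n m j : ℕ} (hm : m < n) (hj : j < m) :
    tP n (m + 1) ⟨j + 1, by omega⟩ = ⟨j, by omega⟩ := by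
  have hm' : m + 1 - 1 < n := by omega
  rw [tP, dif_pos hm', Equiv.Perm.inv_eq_iff_eq, Fin.ext_iff, Fin.coe_cycleRange_of_lt]
  exact Fin.lt_def.mpr hj

theorem tP_succ_pow_apply {n m : ℕ} (hm : m < n) (i : ℕ) (hi : i ≤ m) :
    (tP n (m + 1) ^ i) ⟨m, hm⟩ = ⟨m - i, by omega⟩ := by
  induction i with
  | zero => simp
  | succ i ih =>
    rw [pow_succ', Equiv.Perm.mul_apply, ih (by omega),
      ← tP_succ_apply_succ hm (by omega : m - (i + 1) < m)]
    congr 2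
    omega

theorem tP_pow_apply_of_lt {n m : ℕ} (x : Fin n) (h : m - 1 < x.val) (i : ℕ) :
    (tP n m ^ i) x = x :=
  Equiv.Perm.pow_apply_eq_self_of_apply_eq_self (tP_apply_of_lt x h) i

theorem ogsProd_two_succ {n m : ℕ} (hm : 1 ≤ m) (f : ℕ → Equiv.Perm (Fin n)) :
    ogsProd 2 (m + 1) f = f (m + 1) * ogsProd 2 m f := by
  have h : m + 1 + 1 - 2 = (m + 1 - 2) + 1 := by omega
  have h' : 2 + (m - 1) = m + 1 := by omega
  simp [ogsProd, h, List.range'_1_concat, h']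

theorem ogsProd_two_congr {n m : ℕ} {f g : ℕ → Equiv.Perm (Fin n)}
    (h : ∀ k, 2 ≤ k → k ≤ m → f k = g k) : ogsProd 2 m f = ogsProd 2 m g := by
  unfold ogsProd
  congr 2
  refine List.map_congr_left fun k hk => ?_
  rw [List.mem_range'_1] at hk
  exact h k hk.1 (by omega)

theorem ogsProd_tP_pow_apply_of_le {n m : ℕ} (hm : 1 ≤ m) (i : ℕ → ℕ) (x : Fin n)
    (hx : m ≤ x.val) : ogsProd 2 m (fun j => tP n j ^ i j) x = x := by
  induction m, hm using Nat.le_induction with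
  | base => simp [ogsProd]
  | succ m hm ih =>
    rw [ogsProd_two_succ hm, Equiv.Perm.mul_apply, ih (by omega),
      tP_pow_apply_of_lt x (by omega)]

/-- The canonical form for the permutations fixing every position from `m` on. -/
theorem exists_unique_ogsProd_of_fixes {n m : ℕ} (hm : 1 ≤ m) (hmn : m ≤ n)
    (π : Equiv.Perm (Fin n)) (hπ : ∀ x : Fin n, m ≤ x.val → π x = x) :
    ∃ i : ℕ → ℕ,
      (∀ k, 2 ≤ k → k ≤ m → i k < k) ∧
      π = ogsProd 2 m (fun j => tP n j ^ i j) ∧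
      ∀ i' : ℕ → ℕ, (∀ k, 2 ≤ k → k ≤ m → i' k < k) →
        π = ogsProd 2 m (fun j => tP n j ^ i' j) →
        ∀ k, 2 ≤ k → k ≤ m → i' k = i k := by
  induction m, hm using Nat.le_induction generalizing π with
  | base =>
    refine ⟨fun _ => 0, fun k _ _ => by omega, ?_, fun _ _ _ k _ _ => by omega⟩
    have hfix : ∀ x : Fin n, x ≠ ⟨0, hmn⟩ → π x = x := fun x hx =>
      hπ x (Nat.one_le_iff_ne_zero.mpr fun h => hx (Fin.ext h))
    have h0 : π ⟨0, hmn⟩ = ⟨0, hmn⟩ := by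
      by_contra h
      exact h (π.injective (hfix _ h))
    ext x
    by_cases hx : x = ⟨0, hmn⟩
    · simp [hx, h0, ogsProd]
    · simp [hfix x hx, ogsProd]
  | succ m hm ih =>
    have hm' : m < n := hmn
    have hle : (π ⟨m, hm'⟩).val ≤ m := by
      by_contra h
      have := congrArg Fin.val (π.injective (hπ _ (by omega : m + 1 ≤ (π ⟨m, hm'⟩).val)))
      simp only at this
      omega
    set a := m - (π ⟨m, hm'⟩).val with ha
    have hpow : (tP n (m + 1) ^ a) ⟨m, hm'⟩ = π ⟨m, hm'⟩ := by
      rw [tP_succ_pow_apply hm' a (by omega), Fin.ext_iff]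
      simp only
      omega
    obtain ⟨i, hi, hprod, huniq⟩ := ih (by omega) ((tP n (m + 1) ^ a)⁻¹ * π) (by
      intro x hx
      rw [Equiv.Perm.mul_apply, Equiv.Perm.inv_eq_iff_eq]
      rcases hx.eq_or_lt with h | h
      · obtain rfl : x = ⟨m, hm'⟩ := Fin.ext h.symm
        exact hpow.symm
      · rw [hπ x h, tP_pow_apply_of_lt x (by omega)])
    refine ⟨Function.update i (m + 1) a, fun k hk hkm => ?_, ?_, fun i' hi' hprod' => ?_⟩
    · rcases hkm.eq_or_lt with rfl | h
      · rw [Function.update_self]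
        omega
      · rw [Function.update_of_ne h.ne]
        exact hi k hk (by omega)
    · rw [ogsProd_two_succ hm, Function.update_self, ← inv_mul_eq_iff_eq_mul, hprod]
      refine ogsProd_two_congr fun k _ hk => ?_
      rw [Function.update_of_ne (by omega)]
    · rw [ogsProd_two_succ hm] at hprod'
      have hlt := hi' (m + 1) (by omega) le_rfl
      have happ : π ⟨m, hm'⟩ = ⟨m - i' (m + 1), by omega⟩ := by
        rw [hprod', Equiv.Perm.mul_apply, ogsProd_tP_pow_apply_of_le hm _ _ le_rfl,
          tP_succ_pow_apply hm' _ (by omega)]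
      have htop : i' (m + 1) = a := by
        have := congrArg Fin.val happ
        simp only at this
        omega
      rw [htop, ← inv_mul_eq_iff_eq_mul] at hprod'
      intro k hk hkm
      rcases hkm.eq_or_lt with rfl | h
      · rw [Function.update_self, htop]
      · rw [Function.update_of_ne h.ne]
        exact huniq i' (fun k h₁ h₂ => hi' k h₁ (by omega)) hprod' k hk (by omega)

/-- Every `π ∈ Sₙ` (`n ≥ 2`) has a unique presentation
`π = t₂^{i₂} · t₃^{i₃} ⋯ tₙ^{iₙ}` (factors in increasing order of the index,
left-to-right) with `0 ≤ i_k < k` for all `2 ≤ k ≤ n`. -/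
theorem ogs_canonical_form_increasing (n : ℕ) (hn : 2 ≤ n) (π : Equiv.Perm (Fin n)) :
    ∃ i : ℕ → ℕ,
      (∀ k, 2 ≤ k → k ≤ n → i k < k) ∧
      π = ogsProd 2 n (fun j => tP n j ^ i j) ∧
      ∀ i' : ℕ → ℕ, (∀ k, 2 ≤ k → k ≤ n → i' k < k) →
        π = ogsProd 2 n (fun j => tP n j ^ i' j) →
        ∀ k, 2 ≤ k → k ≤ n → i' k = i k := by
  exact exists_unique_ogsProd_of_fixes (by omega) le_rfl π fun x hx => by omega
end

section
/- For every n ≥ 2 and every permutation π in the symmetric group S_n there exists a unique tuple of integers (i_2, i_3, …, i_n) with 0 ≤ i_k < k for each 2 ≤ k ≤ n such that π = t_n^{i_n} · t_{n−1}^{i_{n−1}} ⋯ t_2^{i_2} (factors in decreasing order of the index). -/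
/-!
Setup for the symmetric group `Sₙ`, realized as `Equiv.Perm (Fin n)` with `Fin n`
encoding `{1, …, n}` (0-indexed positions).  The paper multiplies permutations
left-to-right: `(π·σ)(i) = σ(π(i))`, while Mathlib composes right-to-left:
`(π * σ) i = π (σ i)`.  Hence a paper product `a₁ · a₂ ⋯ a_k` is encoded as the
Mathlib product `a_k * ⋯ * a₂ * a₁` (the leftmost paper factor acts first).
-/

open Equiv Finset

theorem ogsProdDesc_two_succ {n m : ℕ} (hm : 1 ≤ m) (f : ℕ → Equiv.Perm (Fin n)) :
    ogsProdDesc 2 (m + 1) f = ogsProdDesc 2 m f * f (m + 1) := by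
  have h : m + 1 + 1 - 2 = (m + 1 - 2) + 1 := by omega
  have h2 : 2 + (m - 1) = m + 1 := by omega
  simp [ogsProdDesc, h, List.range'_concat, h2]

theorem ogsProdDesc_congr {n a b : ℕ} {f g : ℕ → Equiv.Perm (Fin n)}
    (h : ∀ k, a ≤ k → k ≤ b → f k = g k) : ogsProdDesc a b f = ogsProdDesc a b g := by
  unfold ogsProdDesc
  congr 1
  refine List.map_congr_left fun k hk => ?_
  rw [List.mem_range'_1] at hk
  exact h k hk.1 (by omega)

theorem tP_succ_pow_apply_of_gt {n m : ℕ} (k : ℕ) {x : Fin n} (hx : m < x.val) :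
    (tP n (m + 1) ^ k) x = x := by
  apply Equiv.Perm.pow_apply_eq_self_of_apply_eq_self
  have h : m + 1 - 1 < n := by omega
  rw [tP, dif_pos h, Equiv.Perm.inv_eq_iff_eq]
  exact (Fin.cycleRange_of_gt (Fin.lt_def.2 (by simpa using hx))).symm

theorem ogsProdDesc_tP_pow_apply_of_ge {n m : ℕ} (hm : 1 ≤ m) (i : ℕ → ℕ) {x : Fin n}
    (hx : m ≤ x.val) : ogsProdDesc 2 m (fun j => tP n j ^ i j) x = x := by
  induction m, hm using Nat.le_induction with
  | base => simp [ogsProdDesc]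
  | succ m hm ih =>
    rw [ogsProdDesc_two_succ hm, Equiv.Perm.mul_apply,
      tP_succ_pow_apply_of_gt _ (by omega), ih (by omega)]

theorem tP_succ_pow_inv_apply {n m k : ℕ} (hm : m < n) (hk : k ≤ m) :
    (((tP n (m + 1) ^ k)⁻¹ ⟨m, hm⟩ : Fin n) : ℕ) = if k = 0 then m else k - 1 := by
  have : NeZero n := ⟨by omega⟩
  have ht : (tP n (m + 1))⁻¹ = (⟨m, hm⟩ : Fin n).cycleRange := by
    simp [tP, hm]
  rw [← inv_pow, ht]
  induction k with
  | zero => simp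
  | succ k ih =>
    have ih := ih (by omega)
    rw [pow_succ', Equiv.Perm.mul_apply]
    rcases Nat.eq_zero_or_pos k with rfl | hpos
    · simp
    · rw [if_neg (by omega)] at ih
      rw [Fin.coe_cycleRange_of_lt (Fin.lt_def.2 (by rw [ih]; simp only; omega)), ih,
        if_neg (by omega)]
      omega

/-- The permutations fixing every position `≥ m` have a unique decreasing canonical form in
`t_m, …, t_2`. -/
theorem exists_unique_ogsProdDesc_of_fixes {n m : ℕ} (hm : 1 ≤ m) (hmn : m ≤ n)
    (π : Equiv.Perm (Fin n)) (hπ : ∀ x : Fin n, m ≤ x.val → π x = x) :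
    ∃ i : ℕ → ℕ,
      (∀ k, 2 ≤ k → k ≤ m → i k < k) ∧
      π = ogsProdDesc 2 m (fun j => tP n j ^ i j) ∧
      ∀ i' : ℕ → ℕ, (∀ k, 2 ≤ k → k ≤ m → i' k < k) →
        π = ogsProdDesc 2 m (fun j => tP n j ^ i' j) →
        ∀ k, 2 ≤ k → k ≤ m → i' k = i k := by
  induction m, hm using Nat.le_induction generalizing π with
  | base =>
    refine ⟨fun _ => 0, fun k _ _ => by omega, ?_, fun _ _ _ k _ _ => by omega⟩
    have hone : π = 1 := by
      ext x
      by_cases hx : 1 ≤ x.val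
      · rw [hπ x hx, Equiv.Perm.one_apply]
      · by_cases hy : 1 ≤ (π x).val
        · exact congrArg Fin.val (π.injective (hπ _ hy))
        · rw [Equiv.Perm.one_apply]; omega
    simp [hone, ogsProdDesc]
  | succ m hm ih =>
    let p : Fin n := ⟨m, hmn⟩
    obtain ⟨x, hx⟩ : ∃ x, π x = p := π.surjective p
    have hxm : x.val ≤ m := by
      by_contra! hlt
      have h := congrArg Fin.val ((hπ x hlt).symm.trans hx)
      simp only [p] at h
      omega
    let a : ℕ := if x.val = m then 0 else x.val + 1
    have ham : a ≤ m := by grind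
    have hax : (tP n (m + 1) ^ a)⁻¹ p = x := by
      apply Fin.ext
      rw [tP_succ_pow_inv_apply hmn ham]
      grind
    obtain ⟨i, hi, hprod, huniq⟩ := ih (by omega) (π * (tP n (m + 1) ^ a)⁻¹) (by
      intro y hy
      rw [Equiv.Perm.mul_apply]
      rcases hy.eq_or_lt with h | h
      · obtain rfl : p = y := Fin.ext h
        rw [hax, hx]
      · rw [Equiv.Perm.inv_eq_iff_eq.2 (tP_succ_pow_apply_of_gt a h).symm, hπ y h])
    refine ⟨Function.update i (m + 1) a, ?_, ?_, ?_⟩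
    · intro k hk hkm
      rcases hkm.eq_or_lt with rfl | h
      · rw [Function.update_self]; omega
      · rw [Function.update_of_ne h.ne]; exact hi k hk (by omega)
    · rw [ogsProdDesc_two_succ hm, Function.update_self, ← mul_inv_eq_iff_eq_mul, hprod]
      refine ogsProdDesc_congr fun k _ hk => ?_
      rw [Function.update_of_ne (by omega)]
    · intro i' hi' hprod'
      rw [ogsProdDesc_two_succ hm] at hprod'
      have hlast : i' (m + 1) = a := by
        have hle : i' (m + 1) ≤ m := Nat.le_of_lt_succ (hi' (m + 1) (by omega) le_rfl)
        have hx' : (tP n (m + 1) ^ i' (m + 1))⁻¹ p = x := by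
          apply π.injective
          rw [hx, hprod', Equiv.Perm.mul_apply, ← Equiv.Perm.mul_apply _ _⁻¹, mul_inv_cancel]
          exact ogsProdDesc_tP_pow_apply_of_ge hm i' le_rfl
        have h := congrArg Fin.val hx'
        rw [tP_succ_pow_inv_apply hmn hle] at h
        grind
      intro k hk hkm
      rcases hkm.eq_or_lt with rfl | h
      · rw [Function.update_self, hlast]
      · rw [Function.update_of_ne h.ne]
        refine huniq i' (fun k hk hkm => hi' k hk (by omega)) ?_ k hk (by omega)
        rw [mul_inv_eq_iff_eq_mul, hprod', hlast]

/-- Every `π ∈ Sₙ` (`n ≥ 2`) has a unique presentation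
`π = tₙ^{iₙ} · t_{n−1}^{i_{n−1}} ⋯ t₂^{i₂}` (factors in decreasing order of the
index, left-to-right) with `0 ≤ i_k < k` for all `2 ≤ k ≤ n`. -/
theorem ogs_canonical_form_decreasing (n : ℕ) (hn : 2 ≤ n) (π : Equiv.Perm (Fin n)) :
    ∃ i : ℕ → ℕ,
      (∀ k, 2 ≤ k → k ≤ n → i k < k) ∧
      π = ogsProdDesc 2 n (fun j => tP n j ^ i j) ∧
      ∀ i' : ℕ → ℕ, (∀ k, 2 ≤ k → k ≤ n → i' k < k) →
        π = ogsProdDesc 2 n (fun j => tP n j ^ i' j) →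
        ∀ k, 2 ≤ k → k ≤ n → i' k = i k := by
  exact exists_unique_ogsProdDesc_of_fixes (by omega) le_rfl π fun x hx => absurd x.isLt (by omega)
end

section
/- Let 2 ≤ p < q ≤ n, 0 < i_p < p and 0 < i_q < q. Then in S_n the following exchange laws hold: (i) if q − i_q ≥ p, then t_q^{i_q}·t_p^{i_p} = t_{i_q+i_p}^{i_q}·t_{p+i_q}^{i_p}·t_q^{i_q}; (ii) if i_p ≤ q − i_q ≤ p, then t_q^{i_q}·t_p^{i_p} = t_{i_q}^{p+i_q−q}·t_{i_q+i_p}^{q−p}·t_q^{i_q+i_p}; (iii) if q − i_q ≤ i_p, then t_q^{i_q}·t_p^{i_p} = t_{p+i_q−q}^{i_q+i_p−q}·t_{i_q}^{p−i_p}·t_q^{i_q+i_p−p}. -/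
/-!
Setup for the symmetric group `Sₙ`, realized as `Equiv.Perm (Fin n)` with `Fin n`
encoding `{1, …, n}` (0-indexed positions).  The paper multiplies permutations
left-to-right: `(π·σ)(i) = σ(π(i))`, while Mathlib composes right-to-left:
`(π * σ) i = π (σ i)`.  Hence a paper product `a₁ · a₂ ⋯ a_k` is encoded as the
Mathlib product `a_k * ⋯ * a₂ * a₁` (the leftmost paper factor acts first).
-/

open Equiv Finset

/-- `tP n m` moves every position in `{1, …, m - 1}` (0-indexed) down by one and sends `0` to
`m - 1`. -/
lemma val_tP_apply {n m : ℕ} (hm : m ≤ n) (x : Fin n) :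
    (tP n m x : ℕ) = if x.1 < m then (if x.1 = 0 then m - 1 else x.1 - 1) else x.1 := by
  have hx := x.2
  have hmn : m - 1 < n := by omega
  have : NeZero n := ⟨by omega⟩
  have key : ∀ y : Fin n,
      (y : ℕ) = (if x.1 < m then (if x.1 = 0 then m - 1 else x.1 - 1) else x.1) →
      tP n m x = y := by
    intro y hy
    rw [tP, dif_pos hmn, Equiv.Perm.inv_eq_iff_eq]
    rcases lt_trichotomy y ⟨m - 1, hmn⟩ with h | h | h
    · apply Fin.ext
      rw [Fin.coe_cycleRange_of_lt h]
      rw [Fin.lt_def] at h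
      dsimp only at h
      split_ifs at hy <;> omega
    · rw [Fin.cycleRange_of_eq h]
      apply Fin.ext
      rw [Fin.ext_iff] at h
      dsimp only at h
      rw [Fin.val_zero]
      split_ifs at hy <;> omega
    · rw [Fin.cycleRange_of_gt h]
      apply Fin.ext
      rw [Fin.lt_def] at h
      dsimp only at h
      split_ifs at hy <;> omega
  have hb : (if x.1 < m then (if x.1 = 0 then m - 1 else x.1 - 1) else x.1) < n := by
    split_ifs <;> omega
  rw [key ⟨_, hb⟩ rfl]

/-- The power `tP n m ^ k` with `k ≤ m` rotates the first `m` positions down by `k`. -/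
lemma val_tP_pow_apply {n m k : ℕ} (hm : m ≤ n) (hk : k ≤ m) (x : Fin n) :
    ((tP n m ^ k) x : ℕ) =
      if x.1 < m then (if k ≤ x.1 then x.1 - k else x.1 + m - k) else x.1 := by
  induction k with
  | zero => simp
  | succ k ih =>
    rw [pow_succ', Equiv.Perm.mul_apply, val_tP_apply hm, ih (by omega)]
    split_ifs <;> omega

/-- Exchange laws for `t_q^{i_q} · t_p^{i_p}` (`p < q`), written in
the paper's left-to-right convention, so `t_q^{i_q} · t_p^{i_p}` is encoded as
`tP n p ^ ip * tP n q ^ iq`, and a paper product `a·b·c` as `c * b * a`. -/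
theorem exchange_laws (n p q ip iq : ℕ) (hp : 2 ≤ p) (hpq : p < q) (hq : q ≤ n)
    (hip0 : 0 < ip) (hip : ip < p) (hiq0 : 0 < iq) (hiq : iq < q) :
    (p ≤ q - iq →
      tP n p ^ ip * tP n q ^ iq =
        tP n q ^ iq * tP n (p + iq) ^ ip * tP n (iq + ip) ^ iq) ∧
    (ip ≤ q - iq → q - iq ≤ p →
      tP n p ^ ip * tP n q ^ iq =
        tP n q ^ (iq + ip) * tP n (iq + ip) ^ (q - p) * tP n iq ^ (p + iq - q)) ∧
    (q - iq ≤ ip →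
      tP n p ^ ip * tP n q ^ iq =
        tP n q ^ (iq + ip - p) * tP n iq ^ (p - ip) * tP n (p + iq - q) ^ (iq + ip - q)) := by
  refine ⟨fun h => ?_, fun h₁ h₂ => ?_, fun h => ?_⟩ <;> ext x <;>
    simp only [Equiv.Perm.mul_apply]
  · rw [val_tP_pow_apply (by omega) (by omega), val_tP_pow_apply hq hiq.le,
      val_tP_pow_apply hq hiq.le, val_tP_pow_apply (by omega) (by omega),
      val_tP_pow_apply (by omega) (by omega)]
    grind
  · rw [val_tP_pow_apply (by omega) (by omega), val_tP_pow_apply hq hiq.le,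
      val_tP_pow_apply hq (by omega), val_tP_pow_apply (by omega) (by omega),
      val_tP_pow_apply (by omega) (by omega)]
    grind
  · rw [val_tP_pow_apply (by omega) (by omega), val_tP_pow_apply hq hiq.le,
      val_tP_pow_apply hq (by omega), val_tP_pow_apply (by omega) (by omega),
      val_tP_pow_apply (by omega) (by omega)]
    grind
end

section
/- Let 2 ≤ p < q ≤ n, 0 < i_p < p and 0 < i_q < q. Then in S_n: if q − i_q = p, then t_q^{i_q}·t_p^{i_p} = t_{i_q+i_p}^{i_q}·t_q^{i_q+i_p}; and if q − i_q = i_p, then t_q^{i_q}·t_p^{i_p} = t_{i_q}^{p−i_p}·t_q^{q−p}. -/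
/-!
Setup for the symmetric group `Sₙ`, realized as `Equiv.Perm (Fin n)` with `Fin n`
encoding `{1, …, n}` (0-indexed positions).  The paper multiplies permutations
left-to-right: `(π·σ)(i) = σ(π(i))`, while Mathlib composes right-to-left:
`(π * σ) i = π (σ i)`.  Hence a paper product `a₁ · a₂ ⋯ a_k` is encoded as the
Mathlib product `a_k * ⋯ * a₂ * a₁` (the leftmost paper factor acts first).
-/

open Equiv Finset

/-- The cycle `tₘ` on 0-indexed positions. -/
theorem tP_apply_val (n m : ℕ) (hm0 : 0 < m) (hm : m ≤ n) (x : Fin n) :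
    (tP n m x).val = if x.val < m then (if x.val = 0 then m - 1 else x.val - 1) else x.val := by
  have hn : m - 1 < n := by omega
  obtain ⟨y, rfl⟩ := (⟨m - 1, hn⟩ : Fin n).cycleRange.surjective x
  rw [tP, dif_pos hn, Perm.inv_def, Equiv.symm_apply_apply]
  rcases lt_trichotomy y (⟨m - 1, hn⟩ : Fin n) with h | h | h
  · rw [Fin.coe_cycleRange_of_lt h]
    rw [Fin.lt_def] at h
    grind
  · rw [Fin.coe_cycleRange_of_le h.le, if_pos h]
    simp [h, hm0]
  · rw [Fin.cycleRange_of_gt h]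
    rw [Fin.lt_def] at h
    grind

/-- Closed form for the powers of the cycle `tₘ` on 0-indexed positions. -/
theorem tP_pow_apply_val (n m : ℕ) (hm0 : 0 < m) (hm : m ≤ n) (k : ℕ) (hk : k ≤ m) (x : Fin n) :
    ((tP n m ^ k) x).val = if x.val < m then (if x.val < k then x.val + m - k else x.val - k)
      else x.val := by
  induction k with
  | zero => simp
  | succ k ih =>
    rw [pow_succ', Perm.mul_apply, tP_apply_val n m hm0 hm, ih (by omega)]
    grind

/-- Two-factor exchange laws: if `q − i_q = p` then
`t_q^{i_q}·t_p^{i_p} = t_{i_q+i_p}^{i_q}·t_q^{i_q+i_p}`, and if `q − i_q = i_p` then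
`t_q^{i_q}·t_p^{i_p} = t_{i_q}^{p−i_p}·t_q^{q−p}` (paper products `a·b` encoded as `b * a`). -/
theorem exchange_laws_two_factors (n p q ip iq : ℕ) (hp : 2 ≤ p) (hpq : p < q) (hq : q ≤ n)
    (hip0 : 0 < ip) (hip : ip < p) (hiq0 : 0 < iq) (hiq : iq < q) :
    (q - iq = p →
      tP n p ^ ip * tP n q ^ iq = tP n q ^ (iq + ip) * tP n (iq + ip) ^ iq) ∧
    (q - iq = ip →
      tP n p ^ ip * tP n q ^ iq = tP n q ^ (q - p) * tP n iq ^ (p - ip)) := by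
  have hpn : p ≤ n := by omega
  refine ⟨fun h => ?_, fun h => ?_⟩
  · ext x
    simp only [Perm.mul_apply]
    rw [tP_pow_apply_val n p (by omega) hpn ip hip.le, tP_pow_apply_val n q (by omega) hq iq hiq.le,
      tP_pow_apply_val n q (by omega) hq (iq + ip) (by omega),
      tP_pow_apply_val n (iq + ip) (by omega) (by omega) iq (by omega)]
    grind
  · ext x
    simp only [Perm.mul_apply]
    rw [tP_pow_apply_val n p (by omega) hpn ip hip.le, tP_pow_apply_val n q (by omega) hq iq hiq.le,
      tP_pow_apply_val n q (by omega) hq (q - p) (by omega),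
      tP_pow_apply_val n iq hiq0 (by omega) (p - ip) (by omega)]
    grind
end

section
/- Let 1 ≤ v ≤ k ≤ n−1. If v < k, then in S_n the decreasing run s_k·s_{k−1}⋯s_{k−v+1} equals t_k^{k−v}·t_{k+1}^{v}; and if v = k, then s_k·s_{k−1}⋯s_1 equals t_{k+1}^{k}. -/
/-!
Setup for the symmetric group `Sₙ`, realized as `Equiv.Perm (Fin n)` with `Fin n`
encoding `{1, …, n}` (0-indexed positions).  The paper multiplies permutations
left-to-right: `(π·σ)(i) = σ(π(i))`, while Mathlib composes right-to-left:
`(π * σ) i = π (σ i)`.  Hence a paper product `a₁ · a₂ ⋯ a_k` is encoded as the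
Mathlib product `a_k * ⋯ * a₂ * a₁` (the leftmost paper factor acts first).
-/

open Equiv Finset

/-- The values of an adjacent transposition. -/
lemma sP_succ_apply_val (n i : ℕ) (h : i + 1 < n) (j : Fin n) :
    (sP n (i + 1) j : ℕ) = if (j : ℕ) = i then i + 1 else if (j : ℕ) = i + 1 then i else j := by
  simp only [sP, h, dif_pos, Equiv.swap_apply_def, Fin.ext_iff, Nat.add_sub_cancel]
  split_ifs <;> rfl

/-- The values of a product of consecutive adjacent transpositions: a cycle on an interval. -/
lemma prod_range'_sP_apply_val (n v a : ℕ) (h : a + v < n) (j : Fin n) :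
    ((((List.range' (a + 1) v).map (sP n)).prod j : Fin n) : ℕ) =
      if (j : ℕ) < a ∨ a + v < j then (j : ℕ) else if (j : ℕ) = a + v then a else (j : ℕ) + 1 := by
  induction v generalizing a with
  | zero =>
    simp only [List.range'_zero, List.map_nil, List.prod_nil, Equiv.Perm.one_apply]
    split_ifs <;> omega
  | succ v ih =>
    rw [List.range'_succ, List.map_cons, List.prod_cons, Equiv.Perm.mul_apply,
      sP_succ_apply_val n a (by omega), ih (a + 1) (by omega)]
    split_ifs <;> omega

/-- The values of the cycle `tₘ`. -/
lemma tP_succ_apply_val (n k : ℕ) (h : k < n) (j : Fin n) :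
    (tP n (k + 1) j : ℕ) =
      if k < (j : ℕ) then (j : ℕ) else if (j : ℕ) = 0 then k else (j : ℕ) - 1 := by
  obtain ⟨i, rfl⟩ := (Fin.cycleRange (⟨k, h⟩ : Fin n)).surjective j
  have : NeZero n := ⟨by omega⟩
  have hi : tP n (k + 1) (Fin.cycleRange ⟨k, h⟩ i) = i := by
    rw [tP, dif_pos (by simpa using h)]
    exact Equiv.symm_apply_apply (Fin.cycleRange (⟨k, h⟩ : Fin n)) i
  rw [hi]
  rcases lt_trichotomy i ⟨k, h⟩ with hik | hik | hik
  · rw [Fin.coe_cycleRange_of_lt hik]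
    rw [Fin.lt_def] at hik
    dsimp only at hik
    rw [if_neg (by omega), if_neg (by omega), Nat.add_sub_cancel]
  · rw [Fin.cycleRange_of_eq hik]
    simp [hik]
  · rw [Fin.cycleRange_of_gt hik]
    simp only [Fin.lt_def] at hik
    simp [hik]

/-- The values of the powers of the cycle `tₘ` with exponent less than `m`. -/
lemma tP_succ_pow_apply_val (n k v : ℕ) (h : k < n) (hv : v ≤ k) (j : Fin n) :
    ((tP n (k + 1) ^ v) j : ℕ) =
      if k < (j : ℕ) then (j : ℕ) else if v ≤ (j : ℕ) then (j : ℕ) - v else (j : ℕ) + k + 1 - v := by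
  induction v with
  | zero => simp
  | succ v ih =>
    rw [pow_succ', Equiv.Perm.mul_apply, tP_succ_apply_val n k h, ih (by omega)]
    split_ifs <;> omega

/-- A decreasing run of adjacent transpositions as a product of powers of two cycles. -/
lemma ogsProdDesc_sP_eq (n k v : ℕ) (hv : 1 ≤ v) (hvk : v ≤ k) (hk : k < n) :
    ogsProdDesc (k - v + 1) k (sP n) = tP n (k + 1) ^ v * tP n k ^ (k - v) := by
  obtain ⟨m, rfl⟩ : ∃ m, k = m + 1 := ⟨k - 1, by omega⟩
  ext j
  rw [ogsProdDesc, show m + 1 + 1 - (m + 1 - v + 1) = v by omega,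
    prod_range'_sP_apply_val n v _ (by omega), Equiv.Perm.mul_apply,
    tP_succ_pow_apply_val n (m + 1) v hk hvk,
    tP_succ_pow_apply_val n m (m + 1 - v) (by omega) (by omega)]
  split_ifs <;> omega

/-- For `1 ≤ v ≤ k ≤ n−1`: if `v < k` then
`s_k·s_{k−1}⋯s_{k−v+1} = t_k^{k−v}·t_{k+1}^v`, and if `v = k` then
`s_k·s_{k−1}⋯s_1 = t_{k+1}^k` (paper products encoded in reversed Mathlib order). -/
theorem decreasing_run_eq_t (n k v : ℕ) (hv : 1 ≤ v) (hvk : v ≤ k) (hk : k ≤ n - 1) :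
    (v < k →
      ogsProdDesc (k - v + 1) k (sP n) = tP n (k + 1) ^ v * tP n k ^ (k - v)) ∧
    (v = k →
      ogsProdDesc 1 k (sP n) = tP n (k + 1) ^ k) := by
  refine ⟨fun _ => ogsProdDesc_sP_eq n k v hv hvk (by omega), ?_⟩
  rintro rfl
  simpa using ogsProdDesc_sP_eq n v v hv le_rfl (by omega)
end

section
/- For every 2 ≤ k₁ < k₂ ≤ n and every 1 ≤ v ≤ k₁−1, the Coxeter length of t_{k₁}^{k₁−v}·t_{k₂}^{v} in S_n equals (k₂−k₁)·v. -/
/-!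
Setup for the symmetric group `Sₙ`, realized as `Equiv.Perm (Fin n)` with `Fin n`
encoding `{1, …, n}` (0-indexed positions).  The paper multiplies permutations
left-to-right: `(π·σ)(i) = σ(π(i))`, while Mathlib composes right-to-left:
`(π * σ) i = π (σ i)`.  Hence a paper product `a₁ · a₂ ⋯ a_k` is encoded as the
Mathlib product `a_k * ⋯ * a₂ * a₁` (the leftmost paper factor acts first).
-/

open Equiv Finset

theorem coe_tP_apply {n m : ℕ} (hm : 1 ≤ m) (hmn : m ≤ n) (x : Fin n) :
    (tP n m x : ℕ) = if (x : ℕ) = 0 then m - 1 else if (x : ℕ) < m then (x : ℕ) - 1 else (x : ℕ) := by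
  have h : m - 1 < n := by omega
  obtain ⟨y, rfl⟩ := (⟨m - 1, h⟩ : Fin n).cycleRange.surjective x
  rw [tP, dif_pos h, ← Equiv.Perm.mul_apply, inv_mul_cancel, Equiv.Perm.one_apply]
  rcases lt_trichotomy y ⟨m - 1, h⟩ with hy | rfl | hy
  · rw [Fin.coe_cycleRange_of_lt hy]
    simp only [Fin.lt_def] at hy
    rw [if_neg (Nat.succ_ne_zero _), if_pos (by omega), Nat.add_sub_cancel]
  · rw [Fin.coe_cycleRange_of_le le_rfl]
    simp
  · rw [Fin.cycleRange_of_gt hy]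
    simp only [Fin.lt_def] at hy
    split_ifs <;> omega

theorem coe_tP_pow_apply {n m p : ℕ} (hm : 1 ≤ m) (hmn : m ≤ n) (hp : p ≤ m) (x : Fin n) :
    ((tP n m ^ p) x : ℕ) =
      if (x : ℕ) < p then (x : ℕ) + m - p else if (x : ℕ) < m then (x : ℕ) - p else (x : ℕ) := by
  induction p with
  | zero => simp
  | succ p ih =>
    rw [pow_succ', Equiv.Perm.mul_apply, coe_tP_apply hm hmn, ih (by omega)]
    split_ifs <;> omega

theorem coe_tP_pow_mul_tP_pow_apply {n k₁ k₂ v : ℕ} (h12 : k₁ < k₂) (h2 : k₂ ≤ n)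
    (hv : 1 ≤ v) (hvk : v ≤ k₁) (x : Fin n) :
    ((tP n k₂ ^ v * tP n k₁ ^ (k₁ - v)) x : ℕ) =
      if (x : ℕ) < k₁ - v then (x : ℕ) else if (x : ℕ) < k₁ then (x : ℕ) + (k₂ - k₁)
      else if (x : ℕ) < k₂ then (x : ℕ) - v else (x : ℕ) := by
  rw [Equiv.Perm.mul_apply, coe_tP_pow_apply (by omega) h2 (by omega),
    coe_tP_pow_apply (by omega) (by omega) (by omega)]
  split_ifs <;> omega

/-- For `2 ≤ k₁ < k₂ ≤ n` and `1 ≤ v ≤ k₁−1`, the Coxeter length of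
`t_{k₁}^{k₁−v}·t_{k₂}^{v}` (paper product, encoded as `tP n k₂ ^ v * tP n k₁ ^ (k₁−v)`)
equals `(k₂−k₁)·v`. -/
theorem length_two_factor (n k₁ k₂ v : ℕ) (h1 : 2 ≤ k₁) (h12 : k₁ < k₂) (h2 : k₂ ≤ n)
    (hv : 1 ≤ v) (hvk : v ≤ k₁ - 1) :
    len (tP n k₂ ^ v * tP n k₁ ^ (k₁ - v)) = (k₂ - k₁) * v := by
  have hcard : ∀ a b : ℕ, b ≤ n →
      (univ.filter fun x : Fin n => a ≤ (x : ℕ) ∧ (x : ℕ) < b).card = b - a := by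
    intro a b hb
    rw [← Nat.card_Ico, ← card_map Fin.valEmbedding]
    congr 1
    ext x
    simp only [mem_map, mem_filter, mem_univ, true_and, Fin.valEmbedding_apply, mem_Ico]
    exact ⟨by rintro ⟨y, hy, rfl⟩; exact hy, fun hx => ⟨⟨x, by omega⟩, hx, rfl⟩⟩
  have hprod : (univ.filter fun p : Fin n × Fin n => p.1 < p.2 ∧
      (tP n k₂ ^ v * tP n k₁ ^ (k₁ - v)) p.2 < (tP n k₂ ^ v * tP n k₁ ^ (k₁ - v)) p.1) =
      (univ.filter fun x : Fin n => k₁ - v ≤ (x : ℕ) ∧ (x : ℕ) < k₁) ×ˢ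
        (univ.filter fun x : Fin n => k₁ ≤ (x : ℕ) ∧ (x : ℕ) < k₂) := by
    ext ⟨x, y⟩
    simp only [mem_product, mem_filter, mem_univ, true_and, Fin.lt_def,
      coe_tP_pow_mul_tP_pow_apply h12 h2 hv (show v ≤ k₁ by omega)]
    split_ifs <;> omega
  rw [len, hprod, card_product, hcard _ _ (by omega), hcard _ _ h2, mul_comm]
  congr 1
  omega
end

section
/- Let y_1, …, y_{n−1} be integers with 0 ≤ y_u ≤ u for 1 ≤ u ≤ n−1, and set y_n = 0. Then in S_n the product ∏_{u=1}^{n−1} (s_u·s_{u−1}⋯s_{u−y_u+1}) (outer product in increasing order of u; the u-th inner factor is the decreasing run of y_u adjacent transpositions starting at s_u, empty when y_u = 0) equals ∏_{j=2}^{n} t_j^{i_j} (in increasing order of j), where for 2 ≤ j ≤ n: i_j = y_{j−1} − y_j if y_j ≤ y_{j−1}, and i_j = j + y_{j−1} − y_j if y_j > y_{j−1}. -/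
/-!
Setup for the symmetric group `Sₙ`, realized as `Equiv.Perm (Fin n)` with `Fin n`
encoding `{1, …, n}` (0-indexed positions).  The paper multiplies permutations
left-to-right: `(π·σ)(i) = σ(π(i))`, while Mathlib composes right-to-left:
`(π * σ) i = π (σ i)`.  Hence a paper product `a₁ · a₂ ⋯ a_k` is encoded as the
Mathlib product `a_k * ⋯ * a₂ * a₁` (the leftmost paper factor acts first).
-/

open Equiv Finset

theorem ogsProd_succ {n : ℕ} (a b : ℕ) (h : a ≤ b + 1) (f : ℕ → Equiv.Perm (Fin n)) :
    ogsProd a (b + 1) f = f (b + 1) * ogsProd a b f := by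
  unfold ogsProd
  rw [show b + 1 + 1 - a = (b + 1 - a) + 1 by omega, List.range'_concat]
  simp [show a + (b + 1 - a) = b + 1 by omega]

theorem ogsProdDesc_eq_mul {n : ℕ} (a b : ℕ) (h : a ≤ b) (f : ℕ → Equiv.Perm (Fin n)) :
    ogsProdDesc a b f = f a * ogsProdDesc (a + 1) b f := by
  unfold ogsProdDesc
  rw [show b + 1 - a = (b + 1 - (a + 1)) + 1 by omega, List.range'_succ]
  simp

theorem tP_apply (n m : ℕ) (hm : 1 ≤ m) (hmn : m ≤ n) (x : Fin n) :
    ((tP n m x : Fin n) : ℕ) =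
      if (x : ℕ) = 0 then m - 1 else if (x : ℕ) < m then (x : ℕ) - 1 else x := by
  have : NeZero n := ⟨by omega⟩
  have hlt : m - 1 < n := by omega
  suffices H : ∀ z : Fin n, (Fin.cycleRange ⟨m - 1, hlt⟩ z = x) → tP n m x = z by
    split_ifs with h0 h1
    · rw [H ⟨m - 1, hlt⟩ (by rw [Fin.cycleRange_self]; exact Fin.ext (by simp [h0]))]
    · rw [H ⟨x - 1, by omega⟩]
      apply Fin.ext
      rw [Fin.coe_cycleRange_of_lt (by rw [Fin.lt_def]; simp only; omega)]
      simp only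
      omega
    · rw [H x]
      exact Fin.cycleRange_of_gt (by rw [Fin.lt_def]; simp only; omega)
  intro z hz
  rw [tP, dif_pos hlt, Equiv.Perm.inv_eq_iff_eq, hz]

theorem tP_one (n : ℕ) : tP n 1 = 1 := by
  unfold tP
  split_ifs with h
  · have : NeZero n := ⟨by omega⟩
    have h0 : (⟨1 - 1, h⟩ : Fin n) = 0 := Fin.ext (by simp)
    rw [h0, Fin.cycleRange_zero, inv_one]
  · rfl

theorem tP_pow_self (n m : ℕ) : tP n m ^ m = 1 := by
  unfold tP
  split_ifs with h
  · rcases Nat.lt_or_ge m 2 with h2 | h2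
    · have : NeZero n := ⟨by omega⟩
      have h0 : (⟨m - 1, h⟩ : Fin n) = 0 := Fin.ext (by simp; omega)
      rw [h0, Fin.cycleRange_zero, inv_one, one_pow]
    · have : NeZero n := ⟨by omega⟩
      have hne : (⟨m - 1, h⟩ : Fin n) ≠ 0 := by
        intro e
        have := congrArg Fin.val e
        simp at this
        omega
      have ho : orderOf (Fin.cycleRange (⟨m - 1, h⟩ : Fin n)) = m := by
        rw [← Equiv.Perm.lcm_cycleType, Fin.cycleType_cycleRange hne]
        simp
        omega
      rw [inv_pow, inv_eq_one]
      exact orderOf_dvd_iff_pow_eq_one.mp (dvd_of_eq ho)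
  · exact one_pow m

theorem sP_apply (n i : ℕ) (hin : i < n) (x : Fin n) :
    ((sP n i x : Fin n) : ℕ) =
      if (x : ℕ) = i - 1 then i else if (x : ℕ) = i then i - 1 else x := by
  rw [sP, dif_pos hin, Equiv.swap_apply_def]
  simp only [Fin.ext_iff]
  split_ifs <;> rfl

theorem tP_succ (n u : ℕ) (hu : 1 ≤ u) (hun : u < n) :
    tP n (u + 1) = sP n u * tP n u := by
  ext x
  rw [Equiv.Perm.mul_apply, sP_apply n u hun, tP_apply n u hu hun.le,
    tP_apply n (u + 1) (by omega) hun]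
  split_ifs <;> omega

theorem sP_mul_tP (n m i : ℕ) (hi : 1 ≤ i) (him : i + 1 < m) (hmn : m ≤ n) :
    sP n i * tP n m = tP n m * sP n (i + 1) := by
  ext x
  rw [Equiv.Perm.mul_apply, Equiv.Perm.mul_apply, sP_apply n i (by omega),
    tP_apply n m (by omega) hmn, tP_apply n m (by omega) hmn, sP_apply n (i + 1) (by omega)]
  grind

theorem sP_mul_tP_pow (n u k : ℕ) (hk : k < u) (hun : u < n) :
    sP n (u - k) * tP n (u + 1) ^ k = tP n (u + 1) ^ k * sP n u := by
  induction k with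
  | zero => simp
  | succ k ih =>
    rw [pow_succ', ← mul_assoc, sP_mul_tP n (u + 1) (u - (k + 1)) (by omega) (by omega) hun,
      mul_assoc, show u - (k + 1) + 1 = u - k by omega, ih (by omega), mul_assoc]

/-- A decreasing run of `k` adjacent transpositions starting at `s_u` is
`t_u^{-k} · t_{u+1}^k` (left-to-right). -/
theorem ogsProdDesc_sP (n u k : ℕ) (hk : k ≤ u) (hun : u < n) :
    ogsProdDesc (u - k + 1) u (sP n) * tP n u ^ k = tP n (u + 1) ^ k := by
  induction k with
  | zero => simp [ogsProdDesc]
  | succ k ih =>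
    rw [ogsProdDesc_eq_mul _ _ (by omega), show u - (k + 1) + 1 = u - k by omega, pow_succ,
      mul_assoc, ← mul_assoc (ogsProdDesc _ _ _), ih (by omega), ← mul_assoc,
      sP_mul_tP_pow n u k hk hun, mul_assoc, ← tP_succ n u (by omega) hun, pow_succ]

theorem tP_pow_mul_pow (n j a b : ℕ) (hb : b ≤ j) :
    tP n j ^ b * tP n j ^ (if b ≤ a then a - b else j + a - b) = tP n j ^ a := by
  rw [← pow_add]
  split_ifs with h
  · rw [show b + (a - b) = a by omega]
  · rw [show b + (j + a - b) = j + a by omega, pow_add, tP_pow_self, one_mul]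

theorem ogsProd_ogsProdDesc (n : ℕ) (y : ℕ → ℕ) (hy : ∀ u, 1 ≤ u → u ≤ n - 1 → y u ≤ u)
    (k : ℕ) (hk : k + 1 < n) :
    ogsProd 1 (k + 1) (fun u => ogsProdDesc (u - y u + 1) u (sP n)) =
      tP n (k + 2) ^ y (k + 1) * ogsProd 2 (k + 1) (fun j => tP n j ^
        (if y j ≤ y (j - 1) then y (j - 1) - y j else j + y (j - 1) - y j)) := by
  induction k with
  | zero =>
    have h := ogsProdDesc_sP n 1 (y 1) (hy 1 le_rfl (by omega)) hk
    rw [tP_one, one_pow, mul_one] at h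
    simpa [ogsProd] using h
  | succ k ih =>
    rw [ogsProd_succ _ _ (by omega), ih (by omega), ogsProd_succ 2 (k + 1) (by omega),
      ← ogsProdDesc_sP n (k + 1 + 1) (y (k + 1 + 1)) (hy _ (by omega) (by omega)) hk,
      ← tP_pow_mul_pow n (k + 2) (y (k + 1)) (y (k + 2)) (hy _ (by omega) (by omega))]
    simp only [mul_assoc, Nat.add_sub_cancel]

/-- Normal form to standard OGS canonical form: with `0 ≤ y_u ≤ u`
for `1 ≤ u ≤ n−1` and `y_n = 0`,
`∏_{u=1}^{n−1} (s_u·s_{u−1}⋯s_{u−y_u+1}) = ∏_{j=2}^{n} t_j^{i_j}`, where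
`i_j = y_{j−1} − y_j` if `y_j ≤ y_{j−1}`, and `i_j = j + y_{j−1} − y_j` otherwise.
All products left-to-right in the displayed order. -/
theorem normal_form_to_canonical (n : ℕ) (hn : 2 ≤ n) (y : ℕ → ℕ)
    (hy : ∀ u, 1 ≤ u → u ≤ n - 1 → y u ≤ u) (hyn : y n = 0) :
    ogsProd 1 (n - 1) (fun u => ogsProdDesc (u - y u + 1) u (sP n)) =
      ogsProd 2 n (fun j => tP n j ^
        (if y j ≤ y (j - 1) then y (j - 1) - y j else j + y (j - 1) - y j)) := by
  obtain ⟨k, rfl⟩ : ∃ k, n = k + 2 := ⟨n - 2, by omega⟩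
  rw [show k + 2 - 1 = k + 1 by omega, ogsProd_ogsProdDesc _ y hy k (by omega),
    ogsProd_succ 2 (k + 1) (by omega)]
  simp [hyn]
end

section
/- Let π = ∏_{j=1}^{m} t_{k_j}^{i_{k_j}} be a standard OGS elementary element of S_n, i.e. 2 ≤ k_1 < ⋯ < k_m ≤ n, 0 < i_{k_j} < k_j, and Σ_{j=1}^{m} i_{k_j} ≤ k_1. Let 1 ≤ w ≤ m and let i', i'' ≥ 0 satisfy i' + i'' = i_{k_w}, and set π₁ = (∏_{j=1}^{w−1} t_{k_j}^{i_{k_j}})·t_{k_w}^{i'} and π₂ = t_{k_w}^{i''}·∏_{j=w+1}^{m} t_{k_j}^{i_{k_j}} (so that π = π₁·π₂). If π₁ ≠ 1 and π₂ ≠ 1, then ℓ(π) < ℓ(π₁) + ℓ(π₂). -/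
/-!
Setup for the symmetric group `Sₙ`, realized as `Equiv.Perm (Fin n)` with `Fin n`
encoding `{1, …, n}` (0-indexed positions).  The paper multiplies permutations
left-to-right: `(π·σ)(i) = σ(π(i))`, while Mathlib composes right-to-left:
`(π * σ) i = π (σ i)`.  Hence a paper product `a₁ · a₂ ⋯ a_k` is encoded as the
Mathlib product `a_k * ⋯ * a₂ * a₁` (the leftmost paper factor acts first).
-/

open Equiv Finset

/-- If `τ` inverts a pair that `σ * τ` does not invert, then the lengths of `σ` and `τ` do not
add up to the length of `σ * τ`. -/
lemma len_mul_lt {n : ℕ} (σ τ : Equiv.Perm (Fin n)) {p q : Fin n} (hpq : p < q)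
    (hτ : τ q < τ p) (hσ : σ (τ p) < σ (τ q)) : len (σ * τ) < len τ + len σ := by
  classical
  let Inv (ρ : Equiv.Perm (Fin n)) : Finset (Fin n × Fin n) :=
    Finset.univ.filter fun x => x.1 < x.2 ∧ ρ x.2 < ρ x.1
  have mem_Inv (ρ : Equiv.Perm (Fin n)) (x : Fin n × Fin n) :
      x ∈ Inv ρ ↔ x.1 < x.2 ∧ ρ x.2 < ρ x.1 := by simp [Inv]
  have h_inter : (Inv (σ * τ) ∩ Inv τ).card < (Inv τ).card := by
    refine Finset.card_lt_card ((Finset.ssubset_iff_of_subset Finset.inter_subset_right).2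
      ⟨(p, q), ?_, ?_⟩)
    · simp [mem_Inv, hpq, hτ]
    · simp [mem_Inv, hσ.le]
  have h_sdiff : (Inv (σ * τ) \ Inv τ).card ≤ (Inv σ).card := by
    refine Finset.card_le_card_of_injOn (Prod.map τ τ) ?_
      ((τ.injective.prodMap τ.injective).injOn)
    rintro ⟨x, y⟩ h
    simp only [Finset.mem_coe, Finset.mem_sdiff, mem_Inv, Equiv.Perm.mul_apply, not_and,
      not_lt] at h
    obtain ⟨⟨hxy, hinv⟩, hle⟩ := h
    exact (mem_Inv σ _).2 ⟨lt_of_le_of_ne (hle hxy) (τ.injective.ne hxy.ne), hinv⟩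
  have h_card := Finset.card_sdiff_add_card_inter (Inv (σ * τ)) (Inv τ)
  change (Inv (σ * τ)).card < (Inv τ).card + (Inv σ).card
  omega

lemma tP_apply_of_pos {n k : ℕ} (hkn : k ≤ n) {p : Fin n} (hp : 0 < p.val) (hpk : p.val < k) :
    (tP n k p).val = p.val - 1 := by
  have h : k - 1 < n := by omega
  have hq : tP n k p = ⟨p.val - 1, by omega⟩ := by
    rw [tP, dif_pos h, Equiv.Perm.inv_eq_iff_eq]
    ext
    rw [Fin.coe_cycleRange_of_lt (by simp only [Fin.lt_def]; omega)]
    simp only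
    omega
  rw [hq]

lemma tP_apply_of_eq_zero {n k : ℕ} (hk : 0 < k) (hkn : k ≤ n) {p : Fin n} (hp : p.val = 0) :
    (tP n k p).val = k - 1 := by
  have h : k - 1 < n := by omega
  have : NeZero n := ⟨by omega⟩
  have hq : tP n k p = ⟨k - 1, h⟩ := by
    rw [tP, dif_pos h, Equiv.Perm.inv_eq_iff_eq, Fin.cycleRange_self]
    exact Fin.ext hp
  rw [hq]

lemma tP_pow_apply_of_le {n k : ℕ} (hkn : k ≤ n) {p : Fin n} (hpk : p.val < k) {e : ℕ}
    (he : e ≤ p.val) : ((tP n k ^ e) p).val = p.val - e := by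
  induction e with
  | zero => simp
  | succ e ih =>
    have h := ih (by omega)
    rw [pow_succ', Equiv.Perm.mul_apply, tP_apply_of_pos hkn (by omega) (by omega), h]
    omega

lemma tP_pow_apply_of_lt_s13 {n k : ℕ} (hkn : k ≤ n) {p : Fin n} {e : ℕ} (hpe : p.val < e)
    (hek : e ≤ k) : ((tP n k ^ e) p).val = p.val + k - e := by
  induction e with
  | zero => omega
  | succ e ih =>
    rw [pow_succ', Equiv.Perm.mul_apply]
    rcases (Nat.lt_succ_iff.1 hpe).lt_or_eq with hlt | heq
    · have h := ih hlt (by omega)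
      rw [tP_apply_of_pos hkn (by omega) (by omega), h]
      omega
    · have h := tP_pow_apply_of_le hkn (p := p) (by omega) heq.ge
      rw [tP_apply_of_eq_zero (by omega) hkn (by omega)]
      omega

lemma ogsProd_of_lt {n a b : ℕ} (h : b < a) (f : ℕ → Equiv.Perm (Fin n)) :
    ogsProd a b f = 1 := by
  simp [ogsProd, Nat.sub_eq_zero_of_le (Nat.succ_le_of_lt h)]

lemma ogsProd_eq_mul {n a c b : ℕ} (ha : 1 ≤ a) (hac : a ≤ c) (hcb : c ≤ b) (f : ℕ → Equiv.Perm (Fin n)) :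
    ogsProd a b f = ogsProd (c + 1) b f * f c * ogsProd a (c - 1) f := by
  have h_range : List.range' a (b + 1 - a) =
      List.range' a (c - 1 + 1 - a) ++ c :: List.range' (c + 1) (b + 1 - (c + 1)) := by
    have h := List.range'_append_1 (s := a) (m := c - a) (n := b - c + 1)
    rw [Nat.add_sub_cancel' hac, List.range'_succ] at h
    convert h.symm using 2 <;> grind
  simp [ogsProd, h_range, mul_assoc]

lemma sum_Icc_eq_add {a c b : ℕ} (ha : 1 ≤ a) (hac : a ≤ c) (hcb : c ≤ b) (i : ℕ → ℕ) :
    ∑ j ∈ Finset.Icc a b, i j =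
      ∑ j ∈ Finset.Icc a (c - 1), i j + i c + ∑ j ∈ Finset.Icc (c + 1) b, i j := by
  have h : Finset.Icc a b = insert c (Finset.Icc a (c - 1) ∪ Finset.Icc (c + 1) b) := by
    ext j
    simp only [Finset.mem_Icc, Finset.mem_insert, Finset.mem_union]
    omega
  rw [h, Finset.sum_insert, Finset.sum_union]
  · omega
  · simp only [Finset.disjoint_left, Finset.mem_Icc]
    omega
  · simp only [Finset.mem_Icc, Finset.mem_union]
    omega

/-- On a point that lies below every `k j` and is at least the sum of the exponents, the product
acts as the shift by this sum. -/
lemma ogsProd_tP_pow_apply {n : ℕ} {k i : ℕ → ℕ} {a b : ℕ} {p : Fin n} (ha : 1 ≤ a)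
    (hkn : ∀ j, a ≤ j → j ≤ b → k j ≤ n) (hpk : ∀ j, a ≤ j → j ≤ b → p.val < k j)
    (hsum : ∑ j ∈ Finset.Icc a b, i j ≤ p.val) :
    (ogsProd a b (fun j => tP n (k j) ^ i j) p).val = p.val - ∑ j ∈ Finset.Icc a b, i j := by
  rcases lt_or_ge b a with hba | hab
  · simp [ogsProd_of_lt hba, Finset.Icc_eq_empty_of_lt hba]
  · induction b, hab using Nat.le_induction with
    | base =>
      have h := tP_pow_apply_of_le (hkn a le_rfl le_rfl) (hpk a le_rfl le_rfl)
        (e := i a) (by simpa using hsum)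
      simpa [ogsProd] using h
    | succ b hab ih =>
      have h_sum := sum_Icc_eq_add ha (by omega : a ≤ b + 1) le_rfl i
      simp only [add_tsub_cancel_right, Finset.Icc_eq_empty_of_lt (Nat.lt_succ_self (b + 1)),
        Finset.sum_empty, add_zero] at h_sum
      have h := ih (fun j h₁ h₂ => hkn j h₁ (by omega)) (fun j h₁ h₂ => hpk j h₁ (by omega))
        (by omega)
      have h_lt := hpk (b + 1) (by omega) le_rfl
      rw [ogsProd_eq_mul ha (by omega : a ≤ b + 1) le_rfl, ogsProd_of_lt (Nat.lt_succ_self (b + 1)),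
        one_mul, Equiv.Perm.mul_apply, add_tsub_cancel_right,
        tP_pow_apply_of_le (hkn (b + 1) (by omega) le_rfl) (by omega) (by omega), h]
      omega

/-- The product moves the first point to `k a`, shifted by the sum of the exponents. -/
lemma ogsProd_tP_pow_apply_of_eq_zero {n : ℕ} {k i : ℕ → ℕ} {a b : ℕ} {p : Fin n} (ha : 1 ≤ a)
    (hab : a ≤ b) (hkn : ∀ j, a ≤ j → j ≤ b → k j ≤ n) (hk : ∀ j, a < j → j ≤ b → k a < k j)
    (hi : 0 < i a) (hsum : ∑ j ∈ Finset.Icc a b, i j ≤ k a) (hp : p.val = 0) :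
    (ogsProd a b (fun j => tP n (k j) ^ i j) p).val = k a - ∑ j ∈ Finset.Icc a b, i j := by
  have h_sum := sum_Icc_eq_add ha le_rfl hab i
  rw [Finset.Icc_eq_empty_of_lt (by omega : a - 1 < a), Finset.sum_empty, zero_add] at h_sum
  have h := tP_pow_apply_of_lt_s13 (hkn a le_rfl hab) (p := p) (e := i a) (by omega) (by omega)
  rw [ogsProd_eq_mul ha le_rfl hab, ogsProd_of_lt (by omega : a - 1 < a), mul_one, Equiv.Perm.mul_apply,
    ogsProd_tP_pow_apply (by omega) (fun j h₁ h₂ => hkn j (by omega) h₂)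
      (fun j h₁ h₂ => ?_) (by omega)]
  · omega
  · have := hk j (by omega) h₂
    omega

/-- Let `π = ∏_{j=1}^{m} t_{k_j}^{i_j}` be a standard OGS elementary
element of `Sₙ`, let `1 ≤ w ≤ m`, `i' + i'' = i_w`, and split
`π₁ = (∏_{j=1}^{w−1} t_{k_j}^{i_j})·t_{k_w}^{i'}`, `π₂ = t_{k_w}^{i''}·∏_{j=w+1}^{m} t_{k_j}^{i_j}`
(paper products, encoded in reversed Mathlib order).  If `π₁ ≠ 1` and `π₂ ≠ 1`, then
`ℓ(π) < ℓ(π₁) + ℓ(π₂)`. -/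
theorem elementary_strict_subadditive (n m : ℕ) (k i : ℕ → ℕ) (hm : 1 ≤ m)
    (hk : ∀ j, 1 ≤ j → j ≤ m → 2 ≤ k j ∧ k j ≤ n)
    (hmono : ∀ j, 1 ≤ j → j < m → k j < k (j + 1))
    (hi : ∀ j, 1 ≤ j → j ≤ m → 0 < i j ∧ i j < k j)
    (hsum : ∑ j ∈ Finset.Icc 1 m, i j ≤ k 1)
    (w i' i'' : ℕ) (hw : 1 ≤ w) (hwm : w ≤ m) (hsplit : i' + i'' = i w)
    (π π₁ π₂ : Equiv.Perm (Fin n))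
    (hπ : π = ogsProd 1 m fun j => tP n (k j) ^ i j)
    (hπ₁ : π₁ = tP n (k w) ^ i' * ogsProd 1 (w - 1) (fun j => tP n (k j) ^ i j))
    (hπ₂ : π₂ = ogsProd (w + 1) m (fun j => tP n (k j) ^ i j) * tP n (k w) ^ i'')
    (h1 : π₁ ≠ 1) (h2 : π₂ ≠ 1) :
    len π < len π₁ + len π₂ := by
  have hk_lt : ∀ a b, 1 ≤ a → a < b → b ≤ m → k a < k b := by
    intro a b ha hab hb
    induction b, hab using Nat.le_induction with
    | base => exact hmono a ha hb
    | succ b hab ih => exact (ih (by omega)).trans (hmono b (by omega) hb)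
  have hk_le : ∀ j, 1 ≤ j → j ≤ m → k 1 ≤ k j := fun j h₁ h₂ => by
    rcases h₁.eq_or_lt with rfl | h
    · exact le_rfl
    · exact (hk_lt 1 j le_rfl h h₂).le
  have hkn : ∀ j, 1 ≤ j → j ≤ m → k j ≤ n := fun j h₁ h₂ => (hk j h₁ h₂).2
  have h_sum := sum_Icc_eq_add le_rfl hw hwm i
  have hkw := hk_le w hw hwm
  have hk1 := hk 1 le_rfl hm
  set r := ∑ j ∈ Finset.Icc 1 (w - 1), i j with hr
  set s := ∑ j ∈ Finset.Icc (w + 1) m, i j with hs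
  have h_left : 0 < r + i' := by
    rcases hw.eq_or_lt with rfl | hw1
    · by_contra h
      obtain rfl : i' = 0 := by omega
      exact h1 (by simp [hπ₁, ogsProd])
    · have h := Finset.single_le_sum (f := i) (fun _ _ => Nat.zero_le _)
        (Finset.mem_Icc.2 ⟨le_rfl, (by omega : 1 ≤ w - 1)⟩)
      have := (hi 1 le_rfl hm).1
      omega
  have hwm_of : i'' = 0 → w + 1 ≤ m := by
    rintro rfl
    by_contra h
    obtain rfl : w = m := by omega
    exact h2 (by simp [hπ₂, ogsProd])
  have h_right : 0 < s + i'' := by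
    by_contra h
    have hwm' := hwm_of (by omega)
    have h := Finset.single_le_sum (f := i) (fun _ _ => Nat.zero_le _)
      (Finset.mem_Icc.2 ⟨le_rfl, (by omega : w + 1 ≤ m)⟩)
    have := (hi (w + 1) (by omega) (by omega)).1
    omega
  let p : Fin n := ⟨0, by omega⟩
  let q : Fin n := ⟨r + i', by omega⟩
  have hp : p.val = 0 := rfl
  have hq : q.val = r + i' := rfl
  have hπ₁q : (π₁ q).val = 0 := by
    have h := ogsProd_tP_pow_apply (p := q) le_rfl (fun j h₁ h₂ => hkn j h₁ (by omega))
      (fun j h₁ h₂ => by have := hk_le j h₁ (by omega); omega) (by omega : r ≤ q.val)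
    rw [hπ₁, Equiv.Perm.mul_apply,
      tP_pow_apply_of_le (hkn w hw hwm) (by omega) (by omega), h]
    omega
  have hπ₁p : (π₁ p).val = k 1 - (r + i') := by
    rw [hπ₁, Equiv.Perm.mul_apply]
    rcases hw.eq_or_lt with rfl | hw1
    · have : r = 0 := by simp [hr]
      rw [ogsProd_of_lt (by omega), Equiv.Perm.one_apply,
        tP_pow_apply_of_lt_s13 (hkn 1 le_rfl hm) (by omega) (by omega)]
      omega
    · have h := ogsProd_tP_pow_apply_of_eq_zero (p := p) le_rfl (by omega : 1 ≤ w - 1)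
        (fun j h₁ h₂ => hkn j h₁ (by omega)) (fun j h₁ h₂ => hk_lt 1 j le_rfl h₁ (by omega))
        (hi 1 le_rfl hm).1 (by omega) hp
      rw [← hr] at h
      have := hk_lt 1 w le_rfl hw1 hwm
      rw [tP_pow_apply_of_le (hkn w hw hwm) ?_ ?_, h] <;> omega
  have hπ₂p : (π₂ (π₁ p)).val = k 1 - (r + i') - (s + i'') := by
    have h := tP_pow_apply_of_le (hkn w hw hwm) (p := π₁ p) (e := i'') (by omega) (by omega)
    rw [hπ₂, Equiv.Perm.mul_apply, ogsProd_tP_pow_apply (by omega)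
      (fun j h₁ h₂ => hkn j (by omega) h₂)
      (fun j h₁ h₂ => by have := hk_le j (by omega) h₂; omega) (by omega)]
    omega
  have hπ₂q : k 1 - (s + i'') ≤ (π₂ (π₁ q)).val := by
    rw [hπ₂, Equiv.Perm.mul_apply]
    rcases Nat.eq_zero_or_pos i'' with hi'' | hi''
    · have hwm' := hwm_of hi''
      have := hk_le (w + 1) (by omega) hwm'
      rw [hi'', pow_zero, Equiv.Perm.one_apply, ogsProd_tP_pow_apply_of_eq_zero (by omega) hwm'
        (fun j h₁ h₂ => hkn j (by omega) h₂)
        (fun j h₁ h₂ => hk_lt (w + 1) j (by omega) h₁ h₂) (hi (w + 1) (by omega) hwm').1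
        (by omega) hπ₁q]
      omega
    · have h := tP_pow_apply_of_lt_s13 (hkn w hw hwm) (p := π₁ q) (e := i'') (by omega) (by omega)
      rw [ogsProd_tP_pow_apply (by omega) (fun j h₁ h₂ => hkn j (by omega) h₂)
        (fun j h₁ h₂ => by have := hk_lt w j hw h₁ h₂; omega) (by omega)]
      omega
  have h_mul : π = π₂ * π₁ := by
    rw [hπ, hπ₁, hπ₂, ogsProd_eq_mul le_rfl hw hwm, ← hsplit, add_comm i', pow_add]
    simp only [mul_assoc]
  rw [h_mul]
  refine len_mul_lt π₂ π₁ (p := p) (q := q) ?_ ?_ ?_ <;> rw [Fin.lt_def] <;> omega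
end

section
/- Let π = ∏_{x=1}^{m} t_{k_x}^{i_{k_x}} be an element of S_n presented in standard OGS canonical form, i.e. 2 ≤ k_1 < k_2 < ⋯ < k_m ≤ n and 0 < i_{k_x} < k_x for each x. Then the Coxeter length of π is given by the explicit formula ℓ(π) = Σ_{x=1}^{m} k_x·i_{k_x} − Σ_{c ∈ des(π)} c². -/
/-!
Setup for the symmetric group `Sₙ`, realized as `Equiv.Perm (Fin n)` with `Fin n`
encoding `{1, …, n}` (0-indexed positions).  The paper multiplies permutations
left-to-right: `(π·σ)(i) = σ(π(i))`, while Mathlib composes right-to-left: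
`(π * σ) i = π (σ i)`.  Hence a paper product `a₁ · a₂ ⋯ a_k` is encoded as the
Mathlib product `a_k * ⋯ * a₂ * a₁` (the leftmost paper factor acts first).
-/

open Equiv Finset

lemma tP_apply_val_s15 {n k : ℕ} (hk : 1 ≤ k) (hkn : k ≤ n) (v : Fin n) :
    (tP n k v : ℕ) = if (v : ℕ) = 0 then k - 1 else if (v : ℕ) < k then v - 1 else v := by
  have h : k - 1 < n := by omega
  have : NeZero n := ⟨by omega⟩
  obtain ⟨w, rfl⟩ := (⟨k - 1, h⟩ : Fin n).cycleRange.surjective v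
  have hw : tP n k ((⟨k - 1, h⟩ : Fin n).cycleRange w) = w := by simp [tP, h]
  rw [hw]
  rcases lt_trichotomy w ⟨k - 1, h⟩ with hlt | rfl | hgt
  · rw [Fin.coe_cycleRange_of_lt hlt]
    rw [Fin.lt_def] at hlt
    grind
  · simp
  · rw [Fin.cycleRange_of_gt hgt]
    rw [Fin.lt_def] at hgt
    grind

lemma len_tP_mul {n k : ℕ} (hkn : k ≤ n) (σ : Equiv.Perm (Fin n))
    (hfix : ∀ j : Fin n, k ≤ j → σ j = j) (q : Fin n) (hq : (σ q : ℕ) = 0)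
    (hqk : (q : ℕ) + 1 < k) :
    len (tP n k * σ) + q = len σ + (k - 1 - q) := by
  have ht : ∀ j, ((tP n k * σ) j : ℕ) = _ := fun j => tP_apply_val_s15 (by omega) hkn (σ j)
  have hinj : ∀ a, (σ a : ℕ) = 0 → a = q := fun a ha => σ.injective (Fin.ext (by omega))
  have hlt : ∀ j : Fin n, (j : ℕ) < k → (σ j : ℕ) < k := by
    intro j hj
    by_contra! h
    have := σ.injective (hfix _ h)
    omega
  have hset : (univ.filter fun p : Fin n × Fin n =>
        p.1 < p.2 ∧ (tP n k * σ) p.2 < (tP n k * σ) p.1) ∪ (Iio q ×ˢ {q}) =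
      (univ.filter fun p : Fin n × Fin n => p.1 < p.2 ∧ σ p.2 < σ p.1) ∪
        ({q} ×ˢ Ioc q ⟨k - 1, by omega⟩) := by
    ext ⟨a, b⟩
    simp only [mem_union, mem_filter, mem_univ, true_and, mem_product, mem_Iio, mem_singleton,
      mem_Ioc, Fin.lt_def, Fin.le_def, ht]
    have ha := hinj a
    have hb := hinj b
    have ha' := hlt a
    have hb' := hlt b
    have ha'' := hfix a
    have hb'' := hfix b
    grind
  have hd₁ : Disjoint (univ.filter fun p : Fin n × Fin n =>
        p.1 < p.2 ∧ (tP n k * σ) p.2 < (tP n k * σ) p.1) (Iio q ×ˢ {q}) := by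
    rw [Finset.disjoint_left]
    rintro ⟨a, b⟩
    simp only [mem_filter, mem_univ, true_and, mem_product, mem_Iio, mem_singleton, Fin.lt_def, ht]
    have ha := hlt a
    grind
  have hd₂ : Disjoint (univ.filter fun p : Fin n × Fin n => p.1 < p.2 ∧ σ p.2 < σ p.1)
        ({q} ×ˢ Ioc q ⟨k - 1, by omega⟩) := by
    rw [Finset.disjoint_left]
    rintro ⟨a, b⟩
    simp only [mem_filter, mem_univ, true_and, mem_product, mem_singleton, Fin.lt_def]
    grind
  have := congrArg Finset.card hset
  rw [card_union_of_disjoint hd₁, card_union_of_disjoint hd₂] at this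
  simpa [len] using this

lemma descents_tP_mul {n k : ℕ} (hkn : k ≤ n) (σ : Equiv.Perm (Fin n))
    (hfix : ∀ j : Fin n, k ≤ j → σ j = j) (q : Fin n) (hq : (σ q : ℕ) = 0)
    (hqk : (q : ℕ) + 1 < k) :
    descents (tP n k * σ) = insert ((q : ℕ) + 1) ((descents σ).erase q) := by
  have ht : ∀ j, ((tP n k * σ) j : ℕ) = _ := fun j => tP_apply_val_s15 (by omega) hkn (σ j)
  have hinj : ∀ a, (σ a : ℕ) = 0 → (a : ℕ) = q :=
    fun a ha => congrArg Fin.val (σ.injective (a₁ := a) (a₂ := q) (Fin.ext (by omega)))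
  have hlt : ∀ j : Fin n, (j : ℕ) < k → (σ j : ℕ) < k := by
    intro j hj
    by_contra! h
    have := σ.injective (hfix _ h)
    omega
  have hge : ∀ j : Fin n, k ≤ (j : ℕ) → (σ j : ℕ) = j := fun j hj => by rw [hfix j hj]
  have hq' : ∀ a : Fin n, (a : ℕ) = q → (σ a : ℕ) = 0 := fun a ha => by rw [Fin.ext ha, hq]
  ext c
  simp only [descents, mem_filter, mem_Ico, mem_insert, mem_erase, Fin.lt_def, ht]
  by_cases hc : c < n
  · have h₁ := hinj ⟨c, hc⟩
    have h₂ := hinj ⟨c - 1, by omega⟩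
    have h₃ := hlt ⟨c, hc⟩
    have h₄ := hlt ⟨c - 1, by omega⟩
    have h₅ := hge ⟨c, hc⟩
    have h₆ := hge ⟨c - 1, by omega⟩
    have h₇ := hq' ⟨c, hc⟩
    have h₈ := hq' ⟨c - 1, by omega⟩
    simp only [hc, and_true, exists_true_left] at *
    generalize (σ ⟨c, hc⟩ : ℕ) = x at *
    generalize (σ ⟨c - 1, by omega⟩ : ℕ) = y at *
    clear hge hlt hinj hq' hfix ht
    split_ifs <;> omega
  · have := q.isLt
    exact iff_of_false (by tauto) (by rintro (h | h) <;> omega)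

lemma len_add_sum_descents_tP_mul {n k : ℕ} (hkn : k ≤ n) (σ : Equiv.Perm (Fin n))
    (hfix : ∀ j : Fin n, k ≤ j → σ j = j) (q : Fin n) (hq : (σ q : ℕ) = 0)
    (hqk : (q : ℕ) + 1 < k) :
    len (tP n k * σ) + ∑ c ∈ descents (tP n k * σ), c ^ 2 =
      len σ + ∑ c ∈ descents σ, c ^ 2 + k := by
  have hlen := len_tP_mul hkn σ hfix q hq hqk
  have hmem : (q : ℕ) + 1 ∉ (descents σ).erase q := by
    simp only [descents, mem_erase, mem_filter, Nat.add_sub_cancel, Fin.lt_def, hq]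
    simp
  have hsum : (q : ℕ) ^ 2 + ∑ c ∈ (descents σ).erase q, c ^ 2 = ∑ c ∈ descents σ, c ^ 2 := by
    rcases Nat.eq_zero_or_pos (q : ℕ) with h0 | hpos
    · rw [h0, sum_erase _ (by simp)]
      simp
    · refine add_sum_erase (descents σ) (fun c => c ^ 2) ?_
      simp only [descents, mem_filter, mem_Ico]
      refine ⟨⟨hpos, q.isLt⟩, q.isLt, ?_⟩
      rw [Fin.lt_def, hq, Nat.pos_iff_ne_zero]
      intro h
      have := congrArg Fin.val (σ.injective (Fin.ext (h.trans hq.symm)))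
      simp at this
      omega
  rw [descents_tP_mul hkn σ hfix q hq hqk, sum_insert hmem, ← hsum]
  have : ((q : ℕ) + 1) ^ 2 = (q : ℕ) ^ 2 + 2 * q + 1 := by ring
  omega

lemma tP_pow_mul_apply_of_le {n k : ℕ} (hk : 1 ≤ k) (hkn : k ≤ n) (σ : Equiv.Perm (Fin n))
    (hfix : ∀ j : Fin n, k ≤ j → σ j = j) (p : ℕ) (j : Fin n) (hj : k ≤ j) :
    (tP n k ^ p * σ) j = j := by
  induction p with
  | zero => simpa using hfix j hj
  | succ p ih =>
    rw [pow_succ', mul_assoc, Equiv.Perm.mul_apply, ih]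
    ext
    rw [tP_apply_val_s15 hk hkn]
    grind

lemma len_add_sum_descents_tP_pow_mul {n k : ℕ} (hk : 1 ≤ k) (hkn : k ≤ n)
    (σ : Equiv.Perm (Fin n)) (hfix : ∀ j : Fin n, k ≤ j + 1 → σ j = j) (p : ℕ) (hp : p < k) :
    ((tP n k ^ p * σ) ⟨k - 1, by omega⟩ : ℕ) = k - 1 - p ∧
      len (tP n k ^ p * σ) + ∑ c ∈ descents (tP n k ^ p * σ), c ^ 2 =
        len σ + ∑ c ∈ descents σ, c ^ 2 + k * p := by
  induction p with
  | zero => simp [hfix ⟨k - 1, by omega⟩ (by simp; omega)]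
  | succ p ih =>
    obtain ⟨hlast, hF⟩ := ih (by omega)
    have hge := tP_pow_mul_apply_of_le hk hkn σ (fun j hj => hfix j (by omega)) p
    rw [pow_succ', mul_assoc]
    generalize tP n k ^ p * σ = τ at *
    refine ⟨?_, ?_⟩
    · rw [Equiv.Perm.mul_apply, tP_apply_val_s15 hk hkn, hlast]
      grind
    · obtain ⟨q, hq⟩ := τ.surjective ⟨0, by omega⟩
      have hq0 : (τ q : ℕ) = 0 := by rw [hq]
      have hqk : (q : ℕ) + 1 < k := by
        by_contra! h
        rcases Nat.lt_or_ge (q : ℕ) k with h' | h'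
        · have : q = ⟨k - 1, by omega⟩ := Fin.ext (by simp; omega)
          rw [this] at hq0
          omega
        · rw [hge q h'] at hq0
          omega
      rw [len_add_sum_descents_tP_mul hkn τ hge q hq0 hqk, hF]
      ring

lemma ogsProd_one_succ {n : ℕ} (m : ℕ) (f : ℕ → Equiv.Perm (Fin n)) :
    ogsProd 1 (m + 1) f = f (m + 1) * ogsProd 1 m f := by
  simp [ogsProd, List.range'_concat, add_comm]

lemma len_one (n : ℕ) : len (1 : Equiv.Perm (Fin n)) = 0 := by
  simp only [len, card_eq_zero, filter_eq_empty_iff]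
  rintro ⟨a, b⟩ -
  simpa using fun h : a < b => h.le

lemma descents_one (n : ℕ) : descents (1 : Equiv.Perm (Fin n)) = ∅ := by
  simp only [descents, filter_eq_empty_iff]
  rintro c - ⟨h, h'⟩
  simp [Fin.lt_def] at h'
  omega

lemma ogsProd_fix_and_len_add_sum_descents {n : ℕ} (m : ℕ) (k i : ℕ → ℕ)
    (hk : ∀ x, 1 ≤ x → x ≤ m → 1 ≤ k x ∧ k x ≤ n)
    (hmono : ∀ x, 1 ≤ x → x < m → k x < k (x + 1))
    (hi : ∀ x, 1 ≤ x → x ≤ m → i x < k x) :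
    (∀ j : Fin n, (1 ≤ m → k m ≤ j) → ogsProd 1 m (fun x => tP n (k x) ^ i x) j = j) ∧
      len (ogsProd 1 m fun x => tP n (k x) ^ i x) +
          ∑ c ∈ descents (ogsProd 1 m fun x => tP n (k x) ^ i x), c ^ 2 =
        ∑ x ∈ Finset.Icc 1 m, k x * i x := by
  induction m with
  | zero => simp [ogsProd, len_one, descents_one]
  | succ m ih =>
    obtain ⟨hfix, hF⟩ := ih (fun x h₁ h₂ => hk x h₁ (by omega))
      (fun x h₁ h₂ => hmono x h₁ (by omega)) (fun x h₁ h₂ => hi x h₁ (by omega))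
    obtain ⟨hk₁, hkn⟩ := hk (m + 1) (by omega) le_rfl
    have hfix' : ∀ j : Fin n, k (m + 1) ≤ j + 1 →
        ogsProd 1 m (fun x => tP n (k x) ^ i x) j = j := fun j hj =>
      hfix j fun hm => by
        have := hmono m hm (by omega)
        omega
    rw [ogsProd_one_succ]
    refine ⟨fun j hj => tP_pow_mul_apply_of_le hk₁ hkn _ (fun j hj => hfix' j (by omega)) _ j
      (hj (by omega)), ?_⟩
    rw [(len_add_sum_descents_tP_pow_mul hk₁ hkn _ hfix' _ (hi (m + 1) (by omega) le_rfl)).2, hF,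
      sum_Icc_succ_top (by omega)]

/-- If `π = ∏_{x=1}^{m} t_{k_x}^{i_x}` is in standard OGS canonical
form (`2 ≤ k₁ < ⋯ < k_m ≤ n`, `0 < i_x < k_x`), then
`ℓ(π) = Σ_{x=1}^{m} k_x·i_x − Σ_{c ∈ des(π)} c²`. -/
theorem general_length_formula (n m : ℕ) (k i : ℕ → ℕ) (hm : 1 ≤ m)
    (hk : ∀ x, 1 ≤ x → x ≤ m → 2 ≤ k x ∧ k x ≤ n)
    (hmono : ∀ x, 1 ≤ x → x < m → k x < k (x + 1))
    (hi : ∀ x, 1 ≤ x → x ≤ m → 0 < i x ∧ i x < k x)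
    (π : Equiv.Perm (Fin n)) (hπ : π = ogsProd 1 m fun x => tP n (k x) ^ i x) :
    len π = (∑ x ∈ Finset.Icc 1 m, k x * i x) - ∑ c ∈ descents π, c ^ 2 := by
  have h := (ogsProd_fix_and_len_add_sum_descents m k i
    (fun x h₁ h₂ => ⟨by have := (hk x h₁ h₂).1; omega, (hk x h₁ h₂).2⟩) hmono
    (fun x h₁ h₂ => (hi x h₁ h₂).2)).2
  rw [← hπ] at h
  omega
end

section
/- Let π = t_{k₁}^{i_{k₁}}·t_{k₂}^{i_{k₂}} in S_n with 2 ≤ k₁ < k₂ ≤ n, 0 < i_{k₁} < k₁ and 0 < i_{k₂} < k₂. Then the inverse of π is given by: (i) if i_{k₂} > k₁, then π^{−1} = t_{k₁+k₂−i_{k₁}−i_{k₂}}^{k₂−i_{k₂}}·t_{k₁+k₂−i_{k₂}}^{k₁−i_{k₁}}·t_{k₂}^{k₂−i_{k₂}}; (ii) if i_{k₂} = k₁, then π^{−1} = t_{k₂−i_{k₁}}^{k₂−k₁}·t_{k₂}^{k₂−i_{k₁}}; (iii) if k₁−i_{k₁} < i_{k₂} < k₁, then π^{−1} = t_{k₂−i_{k₂}}^{k₁−i_{k₂}}·t_{k₁+k₂−i_{k₁}−i_{k₂}}^{k₂−k₁}·t_{k₂}^{k₁+k₂−i_{k₁}−i_{k₂}};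 (iv) if i_{k₂} = k₁−i_{k₁}, then π^{−1} = t_{k₂−i_{k₂}}^{i_{k₁}}·t_{k₂}^{k₂−k₁}; (v) if i_{k₂} < k₁−i_{k₁}, then π^{−1} = t_{k₁−i_{k₂}}^{k₁−i_{k₁}−i_{k₂}}·t_{k₂−i_{k₂}}^{i_{k₁}}·t_{k₂}^{k₂−i_{k₁}−i_{k₂}}. -/
/-!
Setup for the symmetric group `Sₙ`, realized as `Equiv.Perm (Fin n)` with `Fin n`
encoding `{1, …, n}` (0-indexed positions).  The paper multiplies permutations
left-to-right: `(π·σ)(i) = σ(π(i))`, while Mathlib composes right-to-left: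
`(π * σ) i = π (σ i)`.  Hence a paper product `a₁ · a₂ ⋯ a_k` is encoded as the
Mathlib product `a_k * ⋯ * a₂ * a₁` (the leftmost paper factor acts first).
-/

open Equiv Finset

/-- Rotation of `{0, …, m - 1}` by `i` steps downwards, extended by the identity. -/
def rotDown (m i x : ℕ) : ℕ :=
  if x < m then (if x < i then x + m - i else x - i) else x

theorem rotDown_cases {m i x y : ℕ} (h : rotDown m i x = y) :
    (x < m ∧ x < i ∧ y = x + m - i) ∨ (x < m ∧ i ≤ x ∧ y = x - i) ∨ (m ≤ x ∧ y = x) := by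
  unfold rotDown at h
  split_ifs at h <;> omega

theorem tP_apply_val_s18 {n m : ℕ} (hm : 0 < m) (hmn : m ≤ n) (x : Fin n) :
    (tP n m x : ℕ) = rotDown m 1 x := by
  have h : m - 1 < n := by omega
  have hn : NeZero n := ⟨by omega⟩
  obtain ⟨y, rfl⟩ := (Fin.cycleRange (⟨m - 1, h⟩ : Fin n)).surjective x
  simp only [tP, dif_pos h, Equiv.Perm.inv_def, Equiv.symm_apply_apply, rotDown]
  rcases lt_trichotomy (y : ℕ) (m - 1) with hy | hy | hy
  · rw [Fin.coe_cycleRange_of_lt (by simpa [Fin.lt_def] using hy)]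
    split_ifs <;> omega
  · rw [Fin.cycleRange_of_eq (by simpa [Fin.ext_iff] using hy)]
    simp [hm, hy]
  · rw [Fin.cycleRange_of_gt (by simpa [Fin.lt_def] using hy)]
    split_ifs <;> omega

theorem tP_pow_apply_val_s18 {n m i : ℕ} (hi : i ≤ m) (hm : 0 < m) (hmn : m ≤ n) (x : Fin n) :
    ((tP n m ^ i) x : ℕ) = rotDown m i x := by
  induction i with
  | zero => simp [rotDown]
  | succ i ih =>
    rw [pow_succ', Equiv.Perm.mul_apply, tP_apply_val_s18 hm hmn, ih (by omega)]
    unfold rotDown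
    split_ifs <;> omega

/-- Inverse of `π = t_{k₁}^{i₁}·t_{k₂}^{i₂}` (`2 ≤ k₁ < k₂ ≤ n`,
`0 < i₁ < k₁`, `0 < i₂ < k₂`), by the five cases of the paper
(paper products encoded in reversed Mathlib order). -/
theorem inverse_two_factor (n k₁ k₂ i₁ i₂ : ℕ) (h1 : 2 ≤ k₁) (h12 : k₁ < k₂) (h2 : k₂ ≤ n)
    (hi₁0 : 0 < i₁) (hi₁ : i₁ < k₁) (hi₂0 : 0 < i₂) (hi₂ : i₂ < k₂)
    (π : Equiv.Perm (Fin n)) (hπ : π = tP n k₂ ^ i₂ * tP n k₁ ^ i₁) :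
    (k₁ < i₂ →
      π⁻¹ = tP n k₂ ^ (k₂ - i₂) * tP n (k₁ + k₂ - i₂) ^ (k₁ - i₁) *
        tP n (k₁ + k₂ - i₁ - i₂) ^ (k₂ - i₂)) ∧
    (i₂ = k₁ →
      π⁻¹ = tP n k₂ ^ (k₂ - i₁) * tP n (k₂ - i₁) ^ (k₂ - k₁)) ∧
    (k₁ - i₁ < i₂ → i₂ < k₁ →
      π⁻¹ = tP n k₂ ^ (k₁ + k₂ - i₁ - i₂) * tP n (k₁ + k₂ - i₁ - i₂) ^ (k₂ - k₁) *
        tP n (k₂ - i₂) ^ (k₁ - i₂)) ∧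
    (i₂ = k₁ - i₁ →
      π⁻¹ = tP n k₂ ^ (k₂ - k₁) * tP n (k₂ - i₂) ^ i₁) ∧
    (i₂ < k₁ - i₁ →
      π⁻¹ = tP n k₂ ^ (k₂ - i₁ - i₂) * tP n (k₂ - i₂) ^ i₁ *
        tP n (k₁ - i₂) ^ (k₁ - i₁ - i₂)) := by
  subst hπ
  refine ⟨fun h => ?_, fun h => ?_, fun h h' => ?_, fun h => ?_, fun h => ?_⟩ <;>
  · rw [inv_eq_iff_mul_eq_one]
    ext x
    simp only [Equiv.Perm.mul_apply, Equiv.Perm.one_apply]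
    repeat rw [tP_pow_apply_val_s18 (by omega) (by omega) (by omega)]
    generalize (x : ℕ) = a
    repeat'
      generalize hab : rotDown _ _ a = b
      rcases rotDown_cases hab with hb | hb | hb <;> clear hab <;>
        first | omega | rename' b => a, a => z
end
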